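/- Let Γ be an infinite group satisfying the Følner condition, let Γ_1, Γ_2, ..., Γ_T ⊆ Γ be finite subsets, each containing the identity, which tile Γ, let δ ∈ (0,1], let n be a positive integer, and let K ⊆ Γ be a finite set. Then there exist a finite set 𝓕 ⊆ Γ and ε > 0 such that: whenever F_1, F_2, ..., F_n ⊆ Γ are mutually disjoint nonempty finite (𝓕, ε)-invariant sets with |F_1| = |F_2| = ⋯ = |F_n|, there exist subsets H_1 ⊆ F_1, ..., H_n ⊆ F_n such that H_i K ⊆ F_i for each i = 1, ..., n, each H_i is tiled by Γ_1, ..., Γ_T with multiplicities divisible by n, |H_1| = |H_2| = ⋯ = |H_n|, and |H_i| > (1 − δ)|F_i| for each i. -/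

import Mathlib

open Pointwise

/-- A finite subset `F` of a group is `(K, ε)`-invariant if `|FK △ F| < ε |F|`. -/
def IsInvariantSet {Γ : Type*} [Group Γ] [DecidableEq Γ] (K : Finset Γ) (ε : ℝ)
    (F : Finset Γ) : Prop :=
  ((symmDiff (F * K) F).card : ℝ) < ε * F.card

/-- A group `Γ` satisfies the Følner condition if for every finite `K ⊆ Γ` and every `ε > 0`
there is a nonempty finite `(K, ε)`-invariant subset of `Γ`. -/
def FolnerCondition (Γ : Type*) [Group Γ] [DecidableEq Γ] : Prop :=
  ∀ K : Finset Γ, ∀ ε : ℝ, 0 < ε → ∃ F : Finset Γ, F.Nonempty ∧ IsInvariantSet K ε F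

/-- The finite sets `S 0, …, S (T-1)` tile the group `Γ`: there are center sets
`C 0, …, C (T-1) ⊆ Γ` such that the left translates `c • S t` (`c ∈ C t`) are pairwise
disjoint and cover `Γ`. -/
def TilesGroup {Γ : Type*} [Group Γ] {T : ℕ} (S : Fin T → Finset Γ) : Prop :=
  ∃ C : Fin T → Set Γ,
    (∀ (t₁ t₂ : Fin T) (c₁ c₂ : Γ), c₁ ∈ C t₁ → c₂ ∈ C t₂ → (t₁, c₁) ≠ (t₂, c₂) →
      Disjoint (c₁ • (S t₁ : Set Γ)) (c₂ • (S t₂ : Set Γ))) ∧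
    (⋃ t : Fin T, ⋃ c ∈ C t, c • (S t : Set Γ)) = Set.univ

/-- A finite set `H ⊆ Γ` is tiled by `S 0, …, S (T-1)` with multiplicities divisible by `n`:
`H` is a disjoint union of left translates of the sets `S t` in which, for each `t`, the
number of translates of `S t` used is divisible by `n`. -/
def TiledWithMultiplicities {Γ : Type*} [Group Γ] [DecidableEq Γ] {T : ℕ}
    (S : Fin T → Finset Γ) (n : ℕ) (H : Finset Γ) : Prop :=
  ∃ D : Fin T → Finset Γ,
    (∀ (t₁ t₂ : Fin T) (c₁ c₂ : Γ), c₁ ∈ D t₁ → c₂ ∈ D t₂ → (t₁, c₁) ≠ (t₂, c₂) →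
      Disjoint (c₁ • S t₁) (c₂ • S t₂)) ∧
    Finset.univ.biUnion (fun t : Fin T => (D t).biUnion fun c => c • S t) = H ∧
    ∀ t, n ∣ (D t).card

lemma exists_le_sum_eq {ι : Type*} (s : Finset ι) (b : ι → ℕ) (q : ℕ)
    (hq : q ≤ ∑ t ∈ s, b t) : ∃ b' : ι → ℕ, (∀ t, b' t ≤ b t) ∧ ∑ t ∈ s, b' t = q := by
  induction q with
  | zero => exact ⟨fun _ => 0, fun _ => Nat.zero_le _, by simp⟩
  | succ q ih =>
    classical
    obtain ⟨b', hb', hsum⟩ := ih (by omega)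
    obtain ⟨t, ht, hlt⟩ : ∃ t ∈ s, b' t < b t :=
      Finset.exists_lt_of_sum_lt (by omega)
    refine ⟨Function.update b' t (b' t + 1), fun u => ?_, ?_⟩
    · by_cases hu : u = t
      · subst hu
        simpa using hlt
      · simpa [hu] using hb' u
    · rw [Finset.sum_update_of_mem ht]
      rw [← Finset.add_sum_erase s b' ht, Finset.erase_eq] at hsum
      omega

/-- Integer weights `s t ∣ L` with multiplicities at most `e t` and divisible by `n` realize every
total `n * L * q` that is at least `n * L * |ι|` below the maximal total. -/
lemma exists_multiplicities {ι : Type*} [Fintype ι] (s e : ι → ℕ) (n L q : ℕ)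
    (hs : ∀ t, 0 < s t) (hL : 0 < L) (hn : 0 < n) (hdvd : ∀ t, s t ∣ L)
    (h : n * L * (q + Fintype.card ι) ≤ ∑ t, e t * s t) :
    ∃ d : ι → ℕ, (∀ t, d t ≤ e t) ∧ (∀ t, n ∣ d t) ∧ ∑ t, d t * s t = n * L * q := by
  have hnL : 0 < n * L := Nat.mul_pos hn hL
  have hq : q ≤ ∑ t, e t * s t / (n * L) := by
    have h1 : ∑ t, e t * s t ≤ ∑ t, n * L * (e t * s t / (n * L) + 1) :=
      Finset.sum_le_sum fun t _ => (Nat.lt_mul_div_succ _ hnL).le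
    rw [← Finset.mul_sum, Finset.sum_add_distrib] at h1
    have h2 := Nat.le_of_mul_le_mul_left (h.trans h1) hnL
    simpa using h2
  obtain ⟨b, hb, hsum⟩ := exists_le_sum_eq _ _ q hq
  have key : ∀ t, b t * n * (L / s t) * s t = n * L * b t := fun t => by
    rw [mul_assoc, Nat.div_mul_cancel (hdvd t)]
    ring
  refine ⟨fun t => b t * n * (L / s t), fun t => ?_, fun t => ⟨b t * (L / s t), by ring⟩, ?_⟩
  · refine Nat.le_of_mul_le_mul_right ?_ (hs t)
    rw [key]
    exact (Nat.mul_le_mul_left _ (hb t)).trans (Nat.mul_div_le _ _)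
  · simp only [key]
    rw [← Finset.mul_sum, hsum]

lemma exists_quotient_between {δ a : ℝ} {f T : ℕ} (hδ1 : δ ≤ 1) (ha : 0 < a)
    (h : 2 * (a * (T + 1)) < δ * f) :
    ∃ q : ℕ, a * (q + T) ≤ (1 - δ / 2) * f ∧ (1 - δ) * f < a * q := by
  have hδf : δ * f ≤ f := mul_le_of_le_one_left (by positivity) hδ1
  have hp1 : a * (⌊(1 - δ / 2) * f / a⌋₊ : ℝ) ≤ (1 - δ / 2) * f := by
    rw [mul_comm, ← le_div_iff₀ ha]
    exact Nat.floor_le (div_nonneg (mul_nonneg (by linarith) (by positivity)) ha.le)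
  have hp2 : (1 - δ / 2) * f < a * ((⌊(1 - δ / 2) * f / a⌋₊ : ℝ) + 1) := by
    rw [mul_comm a, ← div_lt_iff₀ ha]
    exact Nat.lt_floor_add_one _
  generalize ⌊(1 - δ / 2) * f / a⌋₊ = p at hp1 hp2
  have hTp : T ≤ p := by
    have h1 : a * ((T : ℝ) + 1) < a * ((p : ℝ) + 1) := by linarith
    have h2 : (T : ℝ) + 1 < p + 1 := lt_of_mul_lt_mul_left h1 ha.le
    exact_mod_cast (by linarith : (T : ℝ) ≤ p)
  obtain ⟨q, rfl⟩ := Nat.exists_eq_add_of_le' hTp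
  push_cast at hp1 hp2
  exact ⟨q, hp1, by linarith⟩

/-- The cardinality of a disjoint union of translates. -/
lemma card_biUnion_smul {Γ ι : Type*} [Group Γ] [DecidableEq Γ] [Fintype ι]
    (S D : ι → Finset Γ)
    (hD : ∀ (t₁ t₂ : ι) (c₁ c₂ : Γ), c₁ ∈ D t₁ → c₂ ∈ D t₂ → (t₁, c₁) ≠ (t₂, c₂) →
      Disjoint (c₁ • S t₁) (c₂ • S t₂)) :
    (Finset.univ.biUnion fun t => (D t).biUnion fun c => c • S t).card =
      ∑ t, (D t).card * (S t).card := by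
  rw [Finset.card_biUnion]
  · refine Finset.sum_congr rfl fun t _ => ?_
    rw [Finset.card_biUnion]
    · simp
    · exact fun c₁ h₁ c₂ h₂ hne => hD t t c₁ c₂ h₁ h₂ (by simpa using hne)
  · intro t₁ _ t₂ _ hne
    simp only [Finset.disjoint_biUnion_left, Finset.disjoint_biUnion_right]
    exact fun c₂ h₂ c₁ h₁ => hD _ _ _ _ h₁ h₂ (by simp [hne])

/-- In a `(K, ε)`-invariant set, few elements are moved out of the set by some element of `K`. -/
lemma IsInvariantSet.card_filter_le {Γ : Type*} [Group Γ] [DecidableEq Γ] {K F : Finset Γ}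
    {ε : ℝ} (h : IsInvariantSet K ε F) :
    ((F.filter fun x => ∃ k ∈ K, x * k ∉ F).card : ℝ) ≤ K.card * (ε * F.card) := by
  have hsub : (F.filter fun x => ∃ k ∈ K, x * k ∉ F) ⊆
      K.biUnion fun k => F.filter fun x => x * k ∉ F := by
    intro x
    simp only [Finset.mem_filter, Finset.mem_biUnion]
    rintro ⟨hx, k, hk, hxk⟩
    exact ⟨k, hk, hx, hxk⟩
  have hle : ∀ k ∈ K, (F.filter fun x => x * k ∉ F).card ≤ (symmDiff (F * K) F).card := by
    intro k hk
    refine Finset.card_le_card_of_injOn (· * k) (fun x hx => ?_)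
      (mul_left_injective k).injOn
    obtain ⟨hx, hxk⟩ := Finset.mem_filter.1 hx
    exact Finset.mem_symmDiff.2 (Or.inl ⟨Finset.mul_mem_mul hx hk, hxk⟩)
  have hcard := (Finset.card_le_card hsub).trans (Finset.card_biUnion_le_card_mul _ _ _ hle)
  calc ((F.filter fun x => ∃ k ∈ K, x * k ∉ F).card : ℝ)
      ≤ K.card * (symmDiff (F * K) F).card := by exact_mod_cast hcard
    _ ≤ K.card * (ε * F.card) := by gcongr; exact h.le

lemma IsInvariantSet.card_lt {Γ : Type*} [Group Γ] [DecidableEq Γ] {K F : Finset Γ}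
    {ε : ℝ} (h : IsInvariantSet K ε F) (hF : F.Nonempty) (hε : ε ≤ 1) :
    K.card < 2 * F.card := by
  have h1 : (symmDiff (F * K) F).card < F.card := by
    have : ε * F.card ≤ F.card := mul_le_of_le_one_left (by positivity) hε
    exact_mod_cast lt_of_lt_of_le h this
  have h2 : K.card ≤ (F * K).card := Finset.card_le_card_mul_left hF
  have h3 : F * K ⊆ symmDiff (F * K) F ∪ F := by
    intro x hx
    by_cases hxF : x ∈ F <;> simp [Finset.mem_symmDiff, hx, hxF]
  have h4 := (Finset.card_le_card h3).trans (Finset.card_union_le _ _)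
  omega

/-- The tiles that stay inside a sufficiently invariant set `F` after multiplication by `K` cover
most of `F`. -/
lemma TilesGroup.exists_centers {Γ : Type*} [Group Γ] [DecidableEq Γ] {T : ℕ}
    {S : Fin T → Finset Γ} (hid : ∀ t, (1 : Γ) ∈ S t) (htile : TilesGroup S)
    {K 𝓕 F : Finset Γ} (hK : (1 : Γ) ∈ K) {ε : ℝ}
    (h𝓕 : ∀ t, (S t)⁻¹ * (S t * K) ⊆ 𝓕) (hF : IsInvariantSet 𝓕 ε F) :
    ∃ E : Fin T → Finset Γ,
      (∀ (t₁ t₂ : Fin T) (c₁ c₂ : Γ), c₁ ∈ E t₁ → c₂ ∈ E t₂ → (t₁, c₁) ≠ (t₂, c₂) →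
        Disjoint (c₁ • S t₁) (c₂ • S t₂)) ∧
      (∀ t, ∀ c ∈ E t, c • S t * K ⊆ F) ∧
      (1 - 𝓕.card * ε) * F.card ≤ ((∑ t, (E t).card * (S t).card : ℕ) : ℝ) := by
  classical
  obtain ⟨C, hdisj, hcover⟩ := htile
  let E : Fin T → Finset Γ := fun t => F.filter fun c => c ∈ C t ∧ c • S t * K ⊆ F
  have hE : ∀ (t₁ t₂ : Fin T) (c₁ c₂ : Γ), c₁ ∈ E t₁ → c₂ ∈ E t₂ → (t₁, c₁) ≠ (t₂, c₂) →
      Disjoint (c₁ • S t₁) (c₂ • S t₂) := by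
    intro t₁ t₂ c₁ c₂ h₁ h₂ hne
    have := hdisj t₁ t₂ c₁ c₂ (Finset.mem_filter.1 h₁).2.1 (Finset.mem_filter.1 h₂).2.1 hne
    rw [← Finset.disjoint_coe]
    simpa only [Finset.coe_smul_finset] using this
  refine ⟨E, hE, fun t c hc => (Finset.mem_filter.1 hc).2.2, ?_⟩
  rw [← card_biUnion_smul S E hE]
  have hsub : F ⊆ (Finset.univ.biUnion fun t => (E t).biUnion fun c => c • S t) ∪
      F.filter fun x => ∃ k ∈ 𝓕, x * k ∉ F := by
    intro x hx
    by_cases hbad : ∃ k ∈ 𝓕, x * k ∉ F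
    · exact Finset.mem_union_right _ (Finset.mem_filter.2 ⟨hx, hbad⟩)
    push Not at hbad
    have hxu : x ∈ ⋃ t : Fin T, ⋃ c ∈ C t, c • (S t : Set Γ) := hcover ▸ Set.mem_univ x
    simp only [Set.mem_iUnion] at hxu
    obtain ⟨t, c, hc, hxc⟩ := hxu
    obtain ⟨g, hg, rfl⟩ := Set.mem_smul_set.1 hxc
    have hcF : c • S t * K ⊆ F := by
      intro y hy
      obtain ⟨z, hz, k, hk, rfl⟩ := Finset.mem_mul.1 hy
      obtain ⟨g', hg', rfl⟩ := Finset.mem_smul_finset.1 hz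
      have := hbad (g⁻¹ * (g' * k)) (h𝓕 t (Finset.mul_mem_mul (Finset.inv_mem_inv hg)
        (Finset.mul_mem_mul hg' hk)))
      simpa [mul_assoc] using this
    have hcF' : c ∈ F := by
      have := hcF (Finset.mul_mem_mul (Finset.smul_mem_smul_finset (hid t)) hK)
      simpa using this
    refine Finset.mem_union_left _ (Finset.mem_biUnion.2 ⟨t, Finset.mem_univ _,
      Finset.mem_biUnion.2 ⟨c, Finset.mem_filter.2 ⟨hcF', hc, hcF⟩, ?_⟩⟩)
    exact Finset.smul_mem_smul_finset hg
  have hcard : (F.card : ℝ) ≤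
      ((Finset.univ.biUnion fun t => (E t).biUnion fun c => c • S t).card : ℝ) +
        (F.filter fun x => ∃ k ∈ 𝓕, x * k ∉ F).card := by
    exact_mod_cast (Finset.card_le_card hsub).trans (Finset.card_union_le _ _)
  have := hF.card_filter_le
  linarith

/-- A sufficiently invariant set `F` contains a set tiled with multiplicities divisible by `n`,
of any prescribed cardinality `n * L * q` that is not too close to `|F|`. -/
lemma TilesGroup.exists_tiled_subset {Γ : Type*} [Group Γ] [DecidableEq Γ] {T : ℕ}
    {S : Fin T → Finset Γ} (hid : ∀ t, (1 : Γ) ∈ S t) (htile : TilesGroup S)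
    {K 𝓕 F : Finset Γ} (hK : (1 : Γ) ∈ K) {ε : ℝ}
    (h𝓕 : ∀ t, (S t)⁻¹ * (S t * K) ⊆ 𝓕) (hF : IsInvariantSet 𝓕 ε F)
    {n L q : ℕ} (hn : 0 < n) (hL : 0 < L) (hdvd : ∀ t, (S t).card ∣ L)
    (hq : ((n * L * (q + T) : ℕ) : ℝ) ≤ (1 - 𝓕.card * ε) * F.card) :
    ∃ H : Finset Γ, H * K ⊆ F ∧ TiledWithMultiplicities S n H ∧ H.card = n * L * q := by
  obtain ⟨E, hE, hEF, hcard⟩ := htile.exists_centers hid hK h𝓕 hF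
  obtain ⟨d, hd, hdn, hsum⟩ := exists_multiplicities (fun t => (S t).card)
    (fun t => (E t).card) n L q (fun t => Finset.card_pos.2 ⟨1, hid t⟩) hL hn hdvd
    (by rw [Fintype.card_fin]; exact_mod_cast hq.trans hcard)
  choose D hDE hDcard using fun t => Finset.exists_subset_card_eq (hd t)
  have hD : ∀ (t₁ t₂ : Fin T) (c₁ c₂ : Γ), c₁ ∈ D t₁ → c₂ ∈ D t₂ → (t₁, c₁) ≠ (t₂, c₂) →
      Disjoint (c₁ • S t₁) (c₂ • S t₂) :=
    fun t₁ t₂ c₁ c₂ h₁ h₂ => hE t₁ t₂ c₁ c₂ (hDE _ h₁) (hDE _ h₂)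
  refine ⟨_, ?_, ⟨D, hD, rfl, fun t => hDcard t ▸ hdn t⟩, ?_⟩
  · intro y hy
    obtain ⟨z, hz, k, hk, rfl⟩ := Finset.mem_mul.1 hy
    simp only [Finset.mem_biUnion, Finset.mem_univ, true_and] at hz
    obtain ⟨t, c, hc, hz⟩ := hz
    exact hEF t c (hDE t hc) (Finset.mul_mem_mul hz hk)
  · rw [card_biUnion_smul S D hD, ← hsum]
    simp only [hDcard]

/-- Lemma 6.2 of the paper.  Let `Γ` be an infinite group satisfying the
Følner condition, let `S 0, …, S (T-1)` be finite subsets of `Γ`, each containing the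
identity, which tile `Γ`, let `δ ∈ (0,1]`, let `n ≥ 1`, and let `K ⊆ Γ` be finite.  Then
there are a finite set `𝓕 ⊆ Γ` and `ε > 0` such that: whenever `F 0, …, F (n-1)` are
mutually disjoint nonempty finite `(𝓕, ε)`-invariant sets of equal cardinality, there are
`H i ⊆ F i` with `(H i) K ⊆ F i`, each `H i` tiled by `S 0, …, S (T-1)` with multiplicities
divisible by `n`, all `H i` of equal cardinality, and `|H i| > (1 - δ)|F i|` for each `i`. -/
theorem stmt9 {Γ : Type*} [Group Γ] [DecidableEq Γ] [Infinite Γ]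
    (hΓ : FolnerCondition Γ)
    (T : ℕ) (S : Fin T → Finset Γ) (hid : ∀ t, (1 : Γ) ∈ S t) (htile : TilesGroup S)
    (δ : ℝ) (hδ0 : 0 < δ) (hδ1 : δ ≤ 1) (n : ℕ) (hn : 0 < n) (K : Finset Γ) :
    ∃ (𝓕 : Finset Γ) (ε : ℝ), 0 < ε ∧
      ∀ F : Fin n → Finset Γ,
        (∀ i, (F i).Nonempty) →
        (∀ i j, i ≠ j → Disjoint (F i) (F j)) →
        (∀ i, IsInvariantSet 𝓕 ε (F i)) →
        (∀ i j, (F i).card = (F j).card) →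
        ∃ H : Fin n → Finset Γ,
          (∀ i, H i ⊆ F i) ∧
          (∀ i, H i * K ⊆ F i) ∧
          (∀ i, TiledWithMultiplicities S n (H i)) ∧
          (∀ i j, (H i).card = (H j).card) ∧
          (∀ i, (1 - δ) * ((F i).card : ℝ) < ((H i).card : ℝ)) := by
  obtain ⟨L, hL, hdvd⟩ : ∃ L, 0 < L ∧ ∀ t, (S t).card ∣ L :=
    ⟨∏ t, (S t).card, Finset.prod_pos fun t _ => Finset.card_pos.2 ⟨1, hid t⟩,
      fun t => Finset.dvd_prod_of_mem _ (Finset.mem_univ t)⟩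
  obtain ⟨M, hM⟩ := exists_nat_gt (4 * (n * L * (T + 1)) / δ)
  obtain ⟨A, hA⟩ := Infinite.exists_subset_card_eq Γ M
  set K' := insert 1 K
  have hK1 : (1 : Γ) ∈ K' := Finset.mem_insert_self _ _
  set 𝓕 := A ∪ Finset.univ.biUnion fun t => (S t)⁻¹ * (S t * K')
  have h𝓕 : ∀ t, (S t)⁻¹ * (S t * K') ⊆ 𝓕 := fun t =>
    (Finset.subset_biUnion_of_mem (fun t => (S t)⁻¹ * (S t * K')) (Finset.mem_univ t)).trans
      Finset.subset_union_right
  have hM𝓕 : M ≤ 𝓕.card := hA ▸ Finset.card_le_card Finset.subset_union_left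
  have hε0 : 0 < δ / (2 * (𝓕.card + 1)) := by positivity
  have hε1 : δ / (2 * (𝓕.card + 1)) ≤ 1 := by
    rw [div_le_one (by positivity)]
    have : (0 : ℝ) ≤ 𝓕.card := by positivity
    linarith
  have h𝓕ε : 𝓕.card * (δ / (2 * (𝓕.card + 1))) ≤ δ / 2 := by
    rw [← mul_div_assoc, div_le_div_iff₀ (by positivity) (by positivity)]
    nlinarith
  refine ⟨𝓕, _, hε0, fun F hne _ hinv hcard => ?_⟩
  obtain ⟨f, hf⟩ : ∃ f, ∀ i, (F i).card = f := ⟨(F ⟨0, hn⟩).card, fun i => hcard i _⟩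
  have hnL : (0 : ℝ) < n * L := by exact_mod_cast Nat.mul_pos hn hL
  have hfM : 2 * (n * L * (T + 1)) < δ * f := by
    have h1 : (M : ℝ) < 2 * f := by
      exact_mod_cast lt_of_le_of_lt hM𝓕 (hf ⟨0, hn⟩ ▸ (hinv ⟨0, hn⟩).card_lt (hne _) hε1)
    have h2 := hM.trans h1
    rw [div_lt_iff₀ hδ0] at h2
    linarith
  obtain ⟨q, hq1, hq2⟩ := exists_quotient_between hδ1 hnL hfM
  have hH : ∀ i, ∃ H : Finset Γ, H * K' ⊆ F i ∧ TiledWithMultiplicities S n H ∧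
      H.card = n * L * q := fun i => by
    refine htile.exists_tiled_subset hid hK1 h𝓕 (hinv i) hn hL hdvd ?_
    rw [hf i]
    push_cast
    refine hq1.trans ?_
    gcongr
  choose H hHK hHt hHc using hH
  refine ⟨H, fun i => ?_, fun i => ?_, hHt, fun i j => by rw [hHc, hHc], fun i => ?_⟩
  · exact fun x hx => hHK i (by simpa using Finset.mul_mem_mul hx hK1)
  · exact (Finset.mul_subset_mul_left (Finset.subset_insert _ _)).trans (hHK i)
  · rw [hHc, hf]
    exact_mod_cast hq2
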